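/- arXiv:2404.05827 — 2 statements merged into one kernel-verified Lean document; each statement's English description precedes it below -/
import Mathlib

section
/- Let M(z) := ∫₀^{|z|} σ'(σ⁻¹(s))·σ⁻¹(s) ds on I₀ = (−σ(R₀), σ(R₀)). Then M is even, strictly convex, C¹ with M' = μ, and satisfies θ·z²/2 ≤ M(z) ≤ z²/2 for all z ∈ I₀. -/
/-- With `M(z) = ∫₀^{|z|} σ'(σ⁻¹(s))·σ⁻¹(s) ds` on `I₀ = (−σ(R₀), σ(R₀))`,
`M` is even, strictly convex, C¹ with `M' = μ`, and `θz²/2 ≤ M(z) ≤ z²/2` on `I₀`. -/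
theorem stmt_3 (R₀ θ : ℝ) (hR₀ : 0 < R₀) (hθ : θ ∈ Set.Ioc (0:ℝ) 1)
    (σ σ' σinv : ℝ → ℝ)
    (hσcont : ContinuousOn σ (Set.Icc 0 R₀)) (hσ0 : σ 0 = 0)
    (hσ' : ∀ ρ ∈ Set.Ioc (0:ℝ) R₀, HasDerivAt σ (σ' ρ) ρ)
    (hpos : ∀ ρ ∈ Set.Ioc (0:ℝ) R₀, 0 < σ' ρ)
    (hinv1 : ∀ ρ ∈ Set.Icc (0:ℝ) R₀, σinv (σ ρ) = ρ)
    (hinv2 : ∀ s ∈ Set.Icc (0:ℝ) (σ R₀), σ (σinv s) = s)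
    (hinvmem : ∀ s ∈ Set.Ioc (0:ℝ) (σ R₀), σinv s ∈ Set.Ioc (0:ℝ) R₀)
    (μ : ℝ → ℝ)
    (hμ : ∀ z, μ z = Real.sign z * σ' (σinv |z|) * σinv |z|)
    -- (A3)-consequence: `θ ≤ μ' < 1` away from `0`
    (μ' : ℝ → ℝ)
    (hμ' : ∀ z ∈ Set.Ioo (-(σ R₀)) (σ R₀), z ≠ 0 → HasDerivAt μ (μ' z) z)
    (hμ'bound : ∀ z ∈ Set.Ioo (-(σ R₀)) (σ R₀), z ≠ 0 → θ ≤ μ' z ∧ μ' z < 1)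
    (M : ℝ → ℝ)
    (hM : ∀ z, M z = ∫ s in (0:ℝ)..|z|, σ' (σinv s) * σinv s) :
    (∀ z, M z = M (-z)) ∧
    StrictConvexOn ℝ (Set.Ioo (-(σ R₀)) (σ R₀)) M ∧
    (∀ z ∈ Set.Ioo (-(σ R₀)) (σ R₀), HasDerivAt M (μ z) z) ∧
    ContinuousOn μ (Set.Ioo (-(σ R₀)) (σ R₀)) ∧
    (∀ z ∈ Set.Ioo (-(σ R₀)) (σ R₀), θ * z ^ 2 / 2 ≤ M z ∧ M z ≤ z ^ 2 / 2) := by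
  have hσmono : StrictMonoOn σ (Set.Icc 0 R₀) := by
    apply strictMonoOn_of_deriv_pos (convex_Icc 0 R₀) hσcont
    intro x hx
    rw [interior_Icc] at hx
    rw [(hσ' x ⟨hx.1, hx.2.le⟩).deriv]
    exact hpos x ⟨hx.1, hx.2.le⟩
  have ha : 0 < σ R₀ := by
    have := hσmono ⟨le_rfl, hR₀.le⟩ ⟨hR₀.le, le_rfl⟩ hR₀
    rwa [hσ0] at this
  have hμ0 : μ 0 = 0 := by rw [hμ]; simp
  have hodd : ∀ z, μ (-z) = -μ z := by
    intro z
    rw [hμ, hμ, abs_neg, Real.sign_neg]; ring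
  have hμpos' : ∀ s, 0 < s → μ s = σ' (σinv s) * σinv s := by
    intro s hs
    rw [hμ, Real.sign_of_pos hs, abs_of_pos hs, one_mul]
  have hμpos : ∀ s ∈ Set.Ioo 0 (σ R₀), 0 < μ s := by
    intro s hs
    rw [hμpos' s hs.1]
    have h := hinvmem s ⟨hs.1, hs.2.le⟩
    exact mul_pos (hpos _ h) h.1
  have hd : ∀ z ∈ Set.Ioo 0 (σ R₀), HasDerivAt μ (μ' z) z := fun z hz =>
    hμ' z ⟨by linarith [hz.1], hz.2⟩ hz.1.ne'
  have hb : ∀ z ∈ Set.Ioo 0 (σ R₀), θ ≤ μ' z ∧ μ' z < 1 := fun z hz =>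
    hμ'bound z ⟨by linarith [hz.1], hz.2⟩ hz.1.ne'
  have hmono1 : MonotoneOn (fun z => z - μ z) (Set.Ioo 0 (σ R₀)) := by
    apply monotoneOn_of_deriv_nonneg (convex_Ioo _ _)
    · exact fun z hz => ((hasDerivAt_id z).sub (hd z hz)).continuousAt.continuousWithinAt
    · rw [interior_Ioo]
      exact fun z hz => ((hasDerivAt_id z).sub (hd z hz)).differentiableAt.differentiableWithinAt
    · rw [interior_Ioo]
      intro z hz
      have h : HasDerivAt (fun z => z - μ z) (1 - μ' z) z := (hasDerivAt_id z).sub (hd z hz)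
      rw [h.deriv]
      linarith [(hb z hz).2]
  have hmono2 : MonotoneOn (fun z => μ z - θ * z) (Set.Ioo 0 (σ R₀)) := by
    have h : ∀ z ∈ Set.Ioo 0 (σ R₀), HasDerivAt (fun z => μ z - θ * z) (μ' z - θ * 1) z :=
      fun z hz => (hd z hz).sub ((hasDerivAt_id z).const_mul θ)
    apply monotoneOn_of_deriv_nonneg (convex_Ioo _ _)
    · exact fun z hz => (h z hz).continuousAt.continuousWithinAt
    · rw [interior_Ioo]
      exact fun z hz => (h z hz).differentiableAt.differentiableWithinAt
    · rw [interior_Ioo]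
      intro z hz
      rw [(h z hz).deriv]
      linarith [(hb z hz).1]
  have hlow : ∀ t ∈ Set.Ioo 0 (σ R₀), θ * t ≤ μ t := by
    intro t ht
    by_contra! hc
    have hθ0 := hθ.1
    -- choose s small
    set s := min t ((θ * t - μ t) / θ) with hs
    have hs0 : 0 < s := lt_min ht.1 (div_pos (by linarith) hθ0)
    have hst : s ≤ t := min_le_left _ _
    have hs2 : θ * s ≤ θ * t - μ t := by
      have : s ≤ (θ * t - μ t) / θ := min_le_right _ _
      rw [le_div_iff₀ hθ0] at this
      linarith
    have hsm : s ∈ Set.Ioo 0 (σ R₀) := ⟨hs0, hst.trans_lt ht.2⟩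
    have h1 := hmono2 hsm ht hst
    have h2 := hμpos s hsm
    simp only at h1
    linarith
  have hupp : ∀ t ∈ Set.Ioo 0 (σ R₀), μ t ≤ t := by
    intro t ht
    by_contra! hc
    set L := μ t - t with hL
    have hL0 : 0 < L := by linarith
    have hr := hinvmem t ⟨ht.1, ht.2.le⟩
    have hσr := hinv2 t ⟨ht.1.le, ht.2.le⟩
    set r := σinv t with hrdef
    have hD : ∀ ρ ∈ Set.Ioc 0 r, HasDerivAt (fun ρ => σ ρ - L * Real.log ρ)
        (σ' ρ - L * ρ⁻¹) ρ := fun ρ hρ =>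
      (hσ' ρ ⟨hρ.1, hρ.2.trans hr.2⟩).sub ((Real.hasDerivAt_log hρ.1.ne').const_mul L)
    have hm : MonotoneOn (fun ρ => σ ρ - L * Real.log ρ) (Set.Ioc 0 r) := by
      apply monotoneOn_of_deriv_nonneg (convex_Ioc _ _)
      · exact fun z hz => (hD z hz).continuousAt.continuousWithinAt
      · rw [interior_Ioc]
        exact fun z hz =>
          (hD z ⟨hz.1, hz.2.le⟩).differentiableAt.differentiableWithinAt
      · rw [interior_Ioc]
        intro z hz
        rw [(hD z ⟨hz.1, hz.2.le⟩).deriv]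
        have hzR : z ∈ Set.Icc 0 R₀ := ⟨hz.1.le, hz.2.le.trans hr.2⟩
        have h1 : 0 < σ z := by
          have := hσmono ⟨le_rfl, hR₀.le⟩ hzR hz.1
          rwa [hσ0] at this
        have h2 : σ z < t := by
          have := hσmono hzR ⟨hr.1.le, hr.2⟩ hz.2
          rwa [hσr] at this
        have h3 := hmono1 ⟨h1, h2.trans ht.2⟩ ht h2.le
        simp only at h3
        rw [hμpos' _ h1, hinv1 z hzR] at h3
        have h4 : L ≤ σ' z * z := by linarith
        have h5 : L * z⁻¹ ≤ σ' z := by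
          rw [← div_eq_mul_inv, div_le_iff₀ hz.1]; exact h4
        linarith
    have he0 : 0 < Real.exp (-((t + 1) / L)) := Real.exp_pos _
    have he1 : Real.exp (-((t + 1) / L)) ≤ 1 := by
      rw [Real.exp_le_one_iff]
      have : 0 < (t + 1) / L := div_pos (by linarith [ht.1]) hL0
      linarith
    have hp0 : 0 < r * Real.exp (-((t + 1) / L)) := mul_pos hr.1 he0
    have hp1 : r * Real.exp (-((t + 1) / L)) ≤ r := mul_le_of_le_one_right hr.1.le he1
    have h := hm ⟨hp0, hp1⟩ ⟨hr.1, le_rfl⟩ hp1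
    simp only at h
    rw [Real.log_mul hr.1.ne' he0.ne', Real.log_exp, hσr] at h
    have h6 : L * ((t + 1) / L) = t + 1 := by field_simp
    have h7 := hσmono ⟨le_rfl, hR₀.le⟩ ⟨hp0.le, hp1.trans hr.2⟩ hp0
    rw [hσ0] at h7
    nlinarith
  have habs : ∀ z ∈ Set.Ioo (-(σ R₀)) (σ R₀), |μ z| ≤ |z| := by
    intro z hz
    rcases lt_trichotomy z 0 with h | h | h
    · have hm : -z ∈ Set.Ioo 0 (σ R₀) := ⟨by linarith, by linarith [hz.1]⟩
      have h1 := hupp _ hm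
      have h2 := hμpos _ hm
      rw [← abs_neg, ← hodd, ← abs_neg z, abs_of_pos h2, abs_of_pos hm.1]
      exact h1
    · rw [h, hμ0]
    · have hm : z ∈ Set.Ioo 0 (σ R₀) := ⟨h, hz.2⟩
      rw [abs_of_pos (hμpos _ hm), abs_of_pos h]
      exact hupp _ hm
  have hcontAt : ∀ z ∈ Set.Ioo (-(σ R₀)) (σ R₀), ContinuousAt μ z := by
    intro z hz
    by_cases h : z = 0
    · subst h
      unfold ContinuousAt
      rw [hμ0]
      apply squeeze_zero_norm' (a := fun z => |z|)
      · filter_upwards [Ioo_mem_nhds hz.1 hz.2] with x hx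
        exact habs x hx
      · have := (continuous_abs (G := ℝ)).tendsto 0
        simpa using this
    · exact (hμ' z hz h).continuousAt
  have hcont : ContinuousOn μ (Set.Ioo (-(σ R₀)) (σ R₀)) := fun z hz =>
    (hcontAt z hz).continuousWithinAt
  have hMabs : ∀ z, M z = ∫ s in (0:ℝ)..|z|, μ s := by
    intro z
    rw [hM]
    apply intervalIntegral.integral_congr_ae
    refine Filter.Eventually.of_forall fun s hs => ?_
    rw [Set.uIoc_of_le (abs_nonneg z)] at hs
    exact (hμpos' s hs.1).symm
  have hMF : M = fun z => ∫ s in (0:ℝ)..z, μ s := by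
    funext z
    rw [hMabs]
    rcases le_total 0 z with h | h
    · rw [abs_of_nonneg h]
    · rw [abs_of_nonpos h]
      have h1 : ∫ s in (0:ℝ)..(-z), μ s = ∫ s in (0:ℝ)..(-z), -μ (-s) := by
        congr 1; funext s; rw [hodd, neg_neg]
      rw [h1, intervalIntegral.integral_neg, intervalIntegral.integral_comp_neg, neg_neg, neg_zero,
        ← intervalIntegral.integral_symm]
  have hzero : (0:ℝ) ∈ Set.Ioo (-(σ R₀)) (σ R₀) := ⟨by linarith, ha⟩
  have hsub : ∀ z ∈ Set.Ioo (-(σ R₀)) (σ R₀), Set.uIcc 0 z ⊆ Set.Ioo (-(σ R₀)) (σ R₀) :=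
    fun z hz => Set.OrdConnected.uIcc_subset Set.ordConnected_Ioo hzero hz
  have hint : ∀ z ∈ Set.Ioo (-(σ R₀)) (σ R₀), IntervalIntegrable μ MeasureTheory.volume 0 z :=
    fun z hz => (hcont.mono (hsub z hz)).intervalIntegrable
  have hderiv : ∀ z ∈ Set.Ioo (-(σ R₀)) (σ R₀), HasDerivAt M (μ z) z := by
    intro z hz
    rw [hMF]
    exact intervalIntegral.integral_hasDerivAt_right (hint z hz)
      (hcont.stronglyMeasurableAtFilter isOpen_Ioo z hz) (hcontAt z hz)
  have hsm : StrictMonoOn μ (Set.Ioo (-(σ R₀)) (σ R₀)) := by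
    have h1 : StrictMonoOn μ (Set.Ioc (-(σ R₀)) 0) := by
      apply strictMonoOn_of_deriv_pos (convex_Ioc _ _)
        (hcont.mono fun x hx => ⟨hx.1, hx.2.trans_lt ha⟩)
      rw [interior_Ioc]
      intro x hx
      have hx' : x ∈ Set.Ioo (-(σ R₀)) (σ R₀) := ⟨hx.1, hx.2.trans ha⟩
      rw [(hμ' x hx' hx.2.ne).deriv]
      linarith [(hμ'bound x hx' hx.2.ne).1, hθ.1]
    have h2 : StrictMonoOn μ (Set.Ico 0 (σ R₀)) := by
      apply strictMonoOn_of_deriv_pos (convex_Ico _ _)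
        (hcont.mono fun x hx => ⟨by linarith [hx.1], hx.2⟩)
      rw [interior_Ico]
      intro x hx
      rw [(hd x hx).deriv]
      linarith [(hb x hx).1, hθ.1]
    have h3 := h1.union h2 (c := 0) ⟨⟨by linarith, le_rfl⟩, fun x hx => hx.2⟩
      ⟨⟨le_rfl, ha⟩, fun x hx => hx.1⟩
    rwa [Set.Ioc_union_Ico_eq_Ioo (by linarith) ha] at h3
  have heven : ∀ z, M z = M (-z) := fun z => by rw [hM, hM, abs_neg]
  refine ⟨heven, ?_, hderiv, hcont, ?_⟩
  · apply StrictMonoOn.strictConvexOn_of_deriv (convex_Ioo _ _)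
      (fun z hz => (hderiv z hz).continuousAt.continuousWithinAt)
    rw [interior_Ioo]
    intro x hx y hy hxy
    rw [(hderiv x hx).deriv, (hderiv y hy).deriv]
    exact hsm hx hy hxy
  · intro z hz
    have hz' : |z| ∈ Set.Ioo (-(σ R₀)) (σ R₀) :=
      ⟨by linarith [abs_nonneg z], abs_lt.2 hz⟩
    have hI := hint _ hz'
    have hi1 : ∫ s in (0:ℝ)..|z|, θ * s = θ * z ^ 2 / 2 := by
      rw [intervalIntegral.integral_const_mul, integral_id, sq_abs]; ring
    have hi2 : ∫ s in (0:ℝ)..|z|, s = z ^ 2 / 2 := by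
      rw [integral_id, sq_abs]; ring
    rw [hMabs, ← hi1, ← hi2]
    constructor
    · apply intervalIntegral.integral_mono_on (abs_nonneg z)
        ((continuous_const.mul continuous_id).intervalIntegrable _ _) hI
      intro s hs
      rcases hs.1.eq_or_lt with h | h
      · rw [← h, hμ0]; simp
      · exact hlow s ⟨h, hs.2.trans_lt hz'.2⟩
    · apply intervalIntegral.integral_mono_on (abs_nonneg z) hI
        (continuous_id.intervalIntegrable _ _)
      intro s hs
      rcases hs.1.eq_or_lt with h | h
      · rw [← h, hμ0]; simp
      · exact hupp s ⟨h, hs.2.trans_lt hz'.2⟩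
end

section
/- There is a constant a₀ > 0 such that the radius ρ̂(R) of Γ_R ∩ S satisfies a₀·R^{1/θ} ≤ ρ̂(R) ≤ √2·R/(1 + θ·φ₀(√2R)²)^{1/2} for all 0 < R < R₀/√2, where φ₀(R) := inf_{ρ∈(0,R)} σ(ρ)/ρ. -/
theorem le_of_sq_le_sq_aux {a b : ℝ} (h : a ^ 2 ≤ b ^ 2) (hb : 0 ≤ b) : a ≤ b :=
  abs_le_of_sq_le_sq' h hb |>.2

/-- There is `a₀ > 0` with
`a₀·R^{1/θ} ≤ ρ̂(R) ≤ √2·R/(1 + θ·φ₀(√2R)²)^{1/2}` for `0 < R < R₀/√2`,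
where `ρ̂(R)` solves `r²/2 + M(σ(r)) = R²` and `φ₀(R) = inf_{ρ∈(0,R)} σ(ρ)/ρ`. -/
theorem stmt_11 (R₀ θ : ℝ) (hR₀ : 0 < R₀) (hθ : θ ∈ Set.Ioc (0:ℝ) 1)
    (σ σ' σ'' : ℝ → ℝ)
    (hσcont : ContinuousOn σ (Set.Icc 0 R₀)) (hσ0 : σ 0 = 0)
    (hσ' : ∀ ρ ∈ Set.Ioc (0:ℝ) R₀, HasDerivAt σ (σ' ρ) ρ)
    (hσ'' : ∀ ρ ∈ Set.Ioc (0:ℝ) R₀, HasDerivAt σ' (σ'' ρ) ρ)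
    (hpos : ∀ ρ ∈ Set.Ioc (0:ℝ) R₀, 0 < σ' ρ)
    (hA3 : ∀ ρ ∈ Set.Ioc (0:ℝ) R₀, σ'' ρ * ρ / σ' ρ ≥ θ - 1)
    (M : ℝ → ℝ)
    (hMbounds : ∀ z, 0 ≤ z → θ * z ^ 2 / 2 ≤ M z ∧ M z ≤ z ^ 2 / 2)
    (ρhat : ℝ → ℝ)
    (hρhat : ∀ R ∈ Set.Ioo (0:ℝ) (R₀ / Real.sqrt 2),
      ρhat R ∈ Set.Ioc (0:ℝ) R₀ ∧ (ρhat R) ^ 2 / 2 + M (σ (ρhat R)) = R ^ 2)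
    (φ₀ : ℝ → ℝ)
    (hφ₀ : ∀ R ∈ Set.Ioc (0:ℝ) R₀, φ₀ R = sInf {t : ℝ | ∃ ρ ∈ Set.Ioo (0:ℝ) R, t = σ ρ / ρ}) :
    ∃ a₀ : ℝ, 0 < a₀ ∧ ∀ R ∈ Set.Ioo (0:ℝ) (R₀ / Real.sqrt 2),
      a₀ * R ^ (1/θ) ≤ ρhat R ∧
      ρhat R ≤ Real.sqrt 2 * R / Real.sqrt (1 + θ * (φ₀ (Real.sqrt 2 * R)) ^ 2) := by
  obtain ⟨hθ0, hθ1⟩ := hθ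
  have hmono : StrictMonoOn σ (Set.Icc 0 R₀) := by
    apply strictMonoOn_of_deriv_pos (convex_Icc 0 R₀) hσcont
    intro x hx
    rw [interior_Icc] at hx
    rw [(hσ' x ⟨hx.1, hx.2.le⟩).deriv]
    exact hpos x ⟨hx.1, hx.2.le⟩
  have hσpos : ∀ ρ ∈ Set.Ioc (0:ℝ) R₀, 0 < σ ρ := by
    intro ρ hρ
    rw [← hσ0]
    exact hmono ⟨le_rfl, hR₀.le⟩ ⟨hρ.1.le, hρ.2⟩ hρ.1
  have hgd : ∀ x ∈ Set.Ioc (0:ℝ) R₀,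
      HasDerivAt (fun x => x * σ' x - θ * σ x) (1 * σ' x + x * σ'' x - θ * σ' x) x := by
    intro x hx
    exact ((hasDerivAt_id x).mul (hσ'' x hx)).sub ((hσ' x hx).const_mul θ)
  have hg : MonotoneOn (fun x => x * σ' x - θ * σ x) (Set.Ioc 0 R₀) := by
    apply monotoneOn_of_deriv_nonneg (convex_Ioc 0 R₀)
    · intro x hx
      exact (hgd x hx).continuousAt.continuousWithinAt
    · intro x hx
      rw [interior_Ioc] at hx
      exact (hgd x ⟨hx.1, hx.2.le⟩).differentiableAt.differentiableWithinAt
    · intro x hx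
      rw [interior_Ioc] at hx
      have hx' : x ∈ Set.Ioc (0:ℝ) R₀ := ⟨hx.1, hx.2.le⟩
      rw [(hgd x hx').deriv]
      have h1 := hA3 x hx'
      rw [ge_iff_le, le_div_iff₀ (hpos x hx')] at h1
      nlinarith
  have hgnn : ∀ x ∈ Set.Ioc (0:ℝ) R₀, θ * σ x ≤ x * σ' x := by
    intro x hx
    have hlim : Filter.Tendsto σ (nhdsWithin 0 (Set.Ioc 0 x)) (nhds 0) := by
      have h := hσcont 0 ⟨le_rfl, hR₀.le⟩
      rw [ContinuousWithinAt, hσ0] at h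
      exact h.mono_left (nhdsWithin_mono _ (fun y hy => ⟨hy.1.le, hy.2.trans hx.2⟩))
    have hne : (nhdsWithin (0:ℝ) (Set.Ioc 0 x)).NeBot := by
      rw [← mem_closure_iff_nhdsWithin_neBot, closure_Ioc hx.1.ne]
      exact ⟨le_rfl, hx.1.le⟩
    have h2 : Filter.Tendsto (fun y => -(θ * σ y)) (nhdsWithin 0 (Set.Ioc 0 x)) (nhds 0) := by
      simpa using (hlim.const_mul θ).neg
    have h3 : (0:ℝ) ≤ x * σ' x - θ * σ x := by
      refine le_of_tendsto h2 ?_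
      filter_upwards [self_mem_nhdsWithin] with y hy
      have hy' : y ∈ Set.Ioc (0:ℝ) R₀ := ⟨hy.1, hy.2.trans hx.2⟩
      have h4 := hg hy' hx hy.2
      have h5 := mul_pos hy.1 (hpos y hy')
      simp only at h4
      linarith
    linarith
  have hhd : ∀ x ∈ Set.Ioc (0:ℝ) R₀,
      HasDerivAt (fun x => σ x * x ^ (-θ)) (σ' x * x ^ (-θ) + σ x * (-θ * x ^ (-θ - 1))) x := by
    intro x hx
    exact (hσ' x hx).mul (Real.hasDerivAt_rpow_const (Or.inl hx.1.ne'))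
  have hh : MonotoneOn (fun x => σ x * x ^ (-θ)) (Set.Ioc 0 R₀) := by
    apply monotoneOn_of_deriv_nonneg (convex_Ioc 0 R₀)
    · intro x hx
      exact (hhd x hx).continuousAt.continuousWithinAt
    · intro x hx
      rw [interior_Ioc] at hx
      exact (hhd x ⟨hx.1, hx.2.le⟩).differentiableAt.differentiableWithinAt
    · intro x hx
      rw [interior_Ioc] at hx
      have hx' : x ∈ Set.Ioc (0:ℝ) R₀ := ⟨hx.1, hx.2.le⟩
      rw [(hhd x hx').deriv]
      have h1 := hgnn x hx'
      have h2 : x ^ (-θ) = x ^ (-θ - 1) * x := by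
        rw [Real.rpow_sub_one hx.1.ne']
        rw [div_mul_cancel₀ _ hx.1.ne']
      have h3 : 0 < x ^ (-θ - 1) := Real.rpow_pos_of_pos hx.1 _
      rw [h2]
      have : 0 ≤ x ^ (-θ - 1) * (x * σ' x - θ * σ x) := mul_nonneg h3.le (by linarith)
      linarith
  have hbound : ∀ x ∈ Set.Ioc (0:ℝ) R₀, σ x ≤ σ R₀ * (x / R₀) ^ θ := by
    intro x hx
    have h := hh hx ⟨hR₀, le_rfl⟩ hx.2
    simp only at h
    rw [Real.rpow_neg hx.1.le, Real.rpow_neg hR₀.le, ← div_eq_mul_inv,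
      div_le_iff₀ (Real.rpow_pos_of_pos hx.1 _)] at h
    rw [Real.div_rpow hx.1.le hR₀.le]
    calc σ x ≤ _ := h
      _ = _ := by ring
  have hσR := hσpos R₀ ⟨hR₀, le_rfl⟩
  set C := R₀ + σ R₀ with hC
  have hCpos : 0 < C := by positivity
  have hs2 : 0 < Real.sqrt 2 := by positivity
  have hs2s : Real.sqrt 2 ^ 2 = 2 := Real.sq_sqrt (by norm_num)
  refine ⟨R₀ / C ^ (1/θ), by positivity, ?_⟩
  intro R hR
  obtain ⟨hr, heq⟩ := hρhat R hR
  set r := ρhat R with hrdef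
  have hr0 := hr.1
  have hsr := hσpos r hr
  obtain ⟨hM1, hM2⟩ := hMbounds (σ r) hsr.le
  constructor
  · have hk0 : 0 < r / R₀ := div_pos hr0 hR₀
    have hk1 : r / R₀ ≤ 1 := (div_le_one hR₀).2 hr.2
    have hkt : r / R₀ ≤ (r / R₀) ^ θ := Real.self_le_rpow_of_le_one hk0.le hk1 hθ1
    have hb := hbound r hr
    have ht0 : 0 < (r / R₀) ^ θ := Real.rpow_pos_of_pos hk0 _
    have hrt : r ≤ R₀ * (r / R₀) ^ θ := by
      rw [div_le_iff₀ hR₀] at hkt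
      linarith
    have hRC : R ≤ C * (r / R₀) ^ θ := by
      refine le_of_sq_le_sq_aux ?_ (by positivity)
      have : r + σ r ≤ C * (r / R₀) ^ θ := by rw [hC]; linarith
      have h1 : (r + σ r) ^ 2 ≤ (C * (r / R₀) ^ θ) ^ 2 := by gcongr
      nlinarith [mul_pos hr0 hsr]
    have h2 : R / C ≤ (r / R₀) ^ θ := by
      rw [div_le_iff₀ hCpos]; linarith
    have h3 : (R / C) ^ (1/θ) ≤ r / R₀ := by
      calc (R / C) ^ (1/θ) ≤ ((r / R₀) ^ θ) ^ (1/θ) :=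
            Real.rpow_le_rpow (div_nonneg hR.1.le hCpos.le) h2 (by positivity)
        _ = r / R₀ := by
            rw [← Real.rpow_mul hk0.le, mul_one_div_cancel hθ0.ne', Real.rpow_one]
    rw [Real.div_rpow hR.1.le hCpos.le, le_div_iff₀ hR₀] at h3
    calc _ = R ^ (1/θ) / C ^ (1/θ) * R₀ := by ring
      _ ≤ r := h3
  · have hRs : 0 < Real.sqrt 2 * R := mul_pos hs2 hR.1
    have hRR : Real.sqrt 2 * R ≤ R₀ := by
      have := hR.2
      rw [lt_div_iff₀ hs2] at this
      linarith
    have hθσ : 0 < θ * σ r ^ 2 := by positivity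
    have hrlt : r < Real.sqrt 2 * R := by
      apply lt_of_pow_lt_pow_left₀ 2 hRs.le
      rw [mul_pow, hs2s]
      linarith
    have hlow : ∀ t ∈ {t : ℝ | ∃ ρ ∈ Set.Ioo (0:ℝ) (Real.sqrt 2 * R), t = σ ρ / ρ}, 0 ≤ t := by
      rintro t ⟨ρ, hρ, rfl⟩
      exact div_nonneg (hσpos ρ ⟨hρ.1, hρ.2.le.trans hRR⟩).le hρ.1.le
    have hφ := hφ₀ _ ⟨hRs, hRR⟩
    have hφ0 : 0 ≤ φ₀ (Real.sqrt 2 * R) := by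
      rw [hφ]; exact Real.sInf_nonneg hlow
    have hφle : φ₀ (Real.sqrt 2 * R) ≤ σ r / r := by
      rw [hφ]; exact csInf_le ⟨0, hlow⟩ ⟨r, ⟨hr0, hrlt⟩, rfl⟩
    generalize φ₀ (Real.sqrt 2 * R) = p at hφ0 hφle
    rw [le_div_iff₀ hr0] at hφle
    have hD : 0 < 1 + θ * p ^ 2 := by positivity
    rw [le_div_iff₀ (Real.sqrt_pos.2 hD)]
    refine le_of_sq_le_sq_aux ?_ hRs.le
    rw [mul_pow, mul_pow, hs2s, Real.sq_sqrt hD.le]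
    have h1 : (p * r) ^ 2 ≤ σ r ^ 2 := by gcongr
    have h2 : θ * (p * r) ^ 2 ≤ θ * σ r ^ 2 := by gcongr
    nlinarith
end
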